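/- Let d ≥ 2, let M = (μ_A) be a family of probability measures with μ_A supported on A, and suppose there exist constants C > 0 and q > 0 such that for every real r > 1, every B ∈ P^d_∂ with rad(B) ≥ r and every z ∈ B one has μ_B({z}) ≤ C·r^{−q}. Let (F_n) with attachment points (y_n) be incremental aggregation with distribution family M. Then there exist β > 0, c₁ > 0, θ ∈ (0,1) and r₀ ∈ ℕ such that for all integers r ≥ r₀: ℙ(W_r) ≤ c₁·r^{d−1}·θ^r, where W_r = ⋃_{z ∈ Z_r} W_r(z) and, for z = (z_0,…,z_r) ∈ Z_r, W_r(z) is the event that there exist indices j_0 < j_1 < … < j_r ≤ β·r^{1+q} with y_{j_i} = z_i for i = 0,…,r. -/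

import Mathlib

open MeasureTheory Filter

/-- Euclidean norm of a lattice point. -/
noncomputable def zNorm {d : ℕ} (x : Fin d → ℤ) : ℝ :=
  Real.sqrt (∑ i, ((x i : ℝ)) ^ 2)

/-- Two lattice points are adjacent (nearest neighbours) if their Euclidean distance is 1. -/
def adjPt {d : ℕ} (x y : Fin d → ℤ) : Prop := zNorm (x - y) = 1

/-- The radius of a finite set: the maximal Euclidean norm of its points. -/
noncomputable def rad {d : ℕ} (A : Finset (Fin d → ℤ)) : ℝ :=
  if h : A.Nonempty then A.sup' h zNorm else 0

/-- A finite set is connected in the nearest-neighbour graph on `ℤ^d`. -/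
def IsConnCluster {d : ℕ} (A : Finset (Fin d → ℤ)) : Prop :=
  ∀ x ∈ A, ∀ y ∈ A,
    Relation.ReflTransGen (fun a b => a ∈ A ∧ b ∈ A ∧ adjPt a b) x y

/-- The outer boundary of a set `A ⊆ ℤ^d`: the points outside `A` adjacent to a point of `A`. -/
def obdry {d : ℕ} (A : Set (Fin d → ℤ)) : Set (Fin d → ℤ) :=
  {y | y ∉ A ∧ ∃ x ∈ A, adjPt x y}

/-- `B ∈ P^d_∂`: `B` is the outer boundary of some finite connected set containing `0`. -/
def IsOuterBdry {d : ℕ} (B : Finset (Fin d → ℤ)) : Prop :=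
  ∃ A : Finset (Fin d → ℤ), IsConnCluster A ∧ (0 : Fin d → ℤ) ∈ A ∧
    (B : Set (Fin d → ℤ)) = obdry (A : Set (Fin d → ℤ))

/-- A family of probability distributions `μ_A` supported on `A`,
for each finite nonempty `A ⊆ ℤ^d`. -/
def IsDistFamily {d : ℕ} (μ : Set (Fin d → ℤ) → (Fin d → ℤ) → ℝ) : Prop :=
  ∀ A : Set (Fin d → ℤ), A.Finite → A.Nonempty →
    (∀ z, 0 ≤ μ A z) ∧ (∀ z, z ∉ A → μ A z = 0) ∧ (∑' z, μ A z = 1)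

/-- `(F_n)` with attachment points `(y_n)` is incremental aggregation with distribution
family `μ`: `F_1 = {0}` and `y_1 = 0` a.s., `F_{n+1} = F_n ∪ {y_{n+1}}`, and given
`F_n = A` the point `y_{n+1}` is distributed according to `μ_{∂A}`. -/
def IsIncrementalAggregation {d : ℕ} {Ω : Type*} [MeasurableSpace Ω]
    (P : Measure Ω) (μ : Set (Fin d → ℤ) → (Fin d → ℤ) → ℝ)
    (F : ℕ → Ω → Finset (Fin d → ℤ)) (y : ℕ → Ω → (Fin d → ℤ)) : Prop :=
  (∀ᵐ ω ∂P, F 1 ω = {0} ∧ y 1 ω = 0) ∧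
  (∀ n : ℕ, 1 ≤ n → ∀ ω, F (n + 1) ω = insert (y (n + 1) ω) (F n ω)) ∧
  (∀ n : ℕ, 1 ≤ n → ∀ A : Finset (Fin d → ℤ), ∀ v : Fin d → ℤ,
    P ({ω | y (n + 1) ω = v} ∩ {ω | F n ω = A}) =
      ENNReal.ofReal (μ (obdry (A : Set (Fin d → ℤ))) v) * P {ω | F n ω = A})

/-- `x` belongs to the discrete sphere `S_r = {x ∈ ℤ^d : r ≤ ‖x‖ < r+1}`. -/
def inSphere {d : ℕ} (r : ℕ) (x : Fin d → ℤ) : Prop :=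
  (r : ℝ) ≤ zNorm x ∧ zNorm x < (r : ℝ) + 1

/-- `z ∈ Z_r`: a self-avoiding nearest-neighbour path `(z_0,…,z_r)` of length `r`
starting on the discrete sphere `S_r`. -/
def IsZrPath {d : ℕ} (r : ℕ) (z : Fin (r + 1) → (Fin d → ℤ)) : Prop :=
  inSphere r (z 0) ∧ Function.Injective z ∧
    ∀ i : Fin r, adjPt (z i.castSucc) (z i.succ)

/-- The event `W_r(z)`: there exist times `1 ≤ j_0 < j_1 < … < j_r ≤ β·r^{1+q}` at which
the points `z_0, …, z_r` are attached (in this order). -/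
def WrEvent {d : ℕ} {Ω : Type*} (y : ℕ → Ω → (Fin d → ℤ)) (β q : ℝ)
    (r : ℕ) (z : Fin (r + 1) → (Fin d → ℤ)) : Set Ω :=
  {ω | ∃ j : Fin (r + 1) → ℕ, StrictMono j ∧
    (∀ i, 1 ≤ j i ∧ (j i : ℝ) ≤ β * (r : ℝ) ^ ((1 : ℝ) + q)) ∧
    (∀ i, y (j i) ω = z i)}


section helpers

open scoped Classical ENNReal

variable {d : ℕ}

lemma zNorm_eq (x : Fin d → ℤ) :
    zNorm x = ‖(WithLp.toLp 2 (fun i => (x i : ℝ)) : EuclideanSpace ℝ (Fin d))‖ := by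
  simp [zNorm, EuclideanSpace.norm_eq]

lemma zNorm_zero : zNorm (0 : Fin d → ℤ) = 0 := by simp [zNorm]

lemma zNorm_tri (x y : Fin d → ℤ) : zNorm x ≤ zNorm y + zNorm (y - x) := by
  have h := norm_sub_le (WithLp.toLp 2 (fun i => (y i : ℝ)) : EuclideanSpace ℝ (Fin d))
    (WithLp.toLp 2 (fun i => ((y - x) i : ℝ)))
  rw [← zNorm_eq, ← zNorm_eq] at h
  refine le_trans (le_of_eq ?_) h
  rw [zNorm_eq]
  congr 1
  ext i
  simp

lemma zNorm_neg (x : Fin d → ℤ) : zNorm (-x) = zNorm x := by simp [zNorm]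

lemma adjPt_symm {x y : Fin d → ℤ} (h : adjPt x y) : adjPt y x := by
  unfold adjPt at *
  rw [← neg_sub, zNorm_neg, h]

lemma unit_finite : {x : Fin d → ℤ | zNorm x = 1}.Finite := by
  refine (Set.finite_Icc (fun _ => (-1 : ℤ)) (fun _ => (1 : ℤ))).subset ?_
  intro x hx
  have h1 : ∑ i, ((x i : ℝ)) ^ 2 = 1 := by
    have : zNorm x = 1 := hx
    unfold zNorm at this
    rwa [Real.sqrt_eq_one] at this
  have key : ∀ i, -1 ≤ x i ∧ x i ≤ 1 := by
    intro i
    have h2 : ((x i : ℝ)) ^ 2 ≤ 1 := by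
      rw [← h1]
      exact Finset.single_le_sum (f := fun i => ((x i : ℝ)) ^ 2)
        (fun j _ => sq_nonneg _) (Finset.mem_univ i)
    have h3 : (x i) ^ 2 ≤ 1 := by exact_mod_cast h2
    constructor <;> nlinarith
  exact ⟨fun i => (key i).1, fun i => (key i).2⟩

noncomputable def nbrCount (d : ℕ) : ℕ := (unit_finite (d := d)).toFinset.card

lemma obdry_finite (A : Finset (Fin d → ℤ)) : (obdry (A : Set (Fin d → ℤ))).Finite := by
  refine (Set.Finite.biUnion A.finite_toSet
    (fun x _ => (unit_finite (d := d)).image (fun e => x - e))).subset ?_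
  rintro y ⟨_, x, hx, hxy⟩
  simp only [Set.mem_iUnion]
  exact ⟨x, hx, x - y, hxy, by simp⟩

/-- a boundary point farther away than a given point of the set -/
lemma exists_far (hd : 2 ≤ d) (A : Finset (Fin d → ℤ)) {a : Fin d → ℤ} (ha : a ∈ A) :
    ∃ b ∈ obdry (A : Set (Fin d → ℤ)), zNorm a ≤ zNorm b := by
  obtain ⟨x, hx, hmax⟩ := A.exists_max_image zNorm ⟨a, ha⟩
  let i0 : Fin d := ⟨0, by omega⟩
  let σ : ℤ := if 0 ≤ x i0 then 1 else -1
  have hσ : σ = 1 ∧ 0 ≤ x i0 ∨ σ = -1 ∧ x i0 < 0 := by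
    by_cases h : 0 ≤ x i0
    · left; simp [σ, h]
    · right; simp [σ, h]; omega
  let b : Fin d → ℤ := x + Pi.single i0 σ
  have hlt : zNorm x < zNorm b := by
    unfold zNorm
    apply Real.sqrt_lt_sqrt (Finset.sum_nonneg fun _ _ => sq_nonneg _)
    apply Finset.sum_lt_sum
    · intro i _
      by_cases hi : i = i0
      · subst hi
        have : (x i0) ^ 2 ≤ (b i0) ^ 2 := by
          simp only [b, Pi.add_apply, Pi.single_eq_same]
          rcases hσ with ⟨h, h'⟩ | ⟨h, h'⟩ <;> rw [h] <;> nlinarith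
        exact_mod_cast this
      · simp [b, hi]
    · refine ⟨i0, Finset.mem_univ _, ?_⟩
      have : (x i0) ^ 2 < (b i0) ^ 2 := by
        simp only [b, Pi.add_apply, Pi.single_eq_same]
        rcases hσ with ⟨h, h'⟩ | ⟨h, h'⟩ <;> rw [h] <;> nlinarith
      exact_mod_cast this
  refine ⟨b, ⟨fun hb => absurd (hmax b hb) (not_le.2 hlt), x, hx, ?_⟩,
    (hmax a ha).trans hlt.le⟩
  have hs : σ ^ 2 = 1 := by
    rcases hσ with ⟨h, _⟩ | ⟨h, _⟩ <;> rw [h] <;> norm_num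
  unfold adjPt zNorm
  rw [Real.sqrt_eq_one, Finset.sum_eq_single i0]
  · simp only [b, Pi.sub_apply, Pi.add_apply, Pi.single_eq_same]
    have : (x i0 - (x i0 + σ)) ^ 2 = 1 := by rw [← hs]; ring
    exact_mod_cast this
  · intro i _ hi
    simp [b, hi]
  · simp

/-- histories (newest point first) which grow by boundary points -/
inductive ValidH : List (Fin d → ℤ) → Prop
  | base : ValidH [0]
  | step (v : Fin d → ℤ) (h : List (Fin d → ℤ)) : ValidH h →
      v ∈ obdry (h.toFinset : Set (Fin d → ℤ)) → ValidH (v :: h)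

lemma ValidH.zero_mem {h : List (Fin d → ℤ)} (hh : ValidH h) : (0 : Fin d → ℤ) ∈ h := by
  induction hh with
  | base => simp
  | step v h _ _ ih => simp [ih]

lemma conn_insert {A : Finset (Fin d → ℤ)} (hA : IsConnCluster A) {x v : Fin d → ℤ}
    (hx : x ∈ A) (hxv : adjPt x v) : IsConnCluster (insert v A) := by
  have mono : ∀ a b, Relation.ReflTransGen (fun a b => a ∈ A ∧ b ∈ A ∧ adjPt a b) a b →
      Relation.ReflTransGen
        (fun a b => a ∈ insert v A ∧ b ∈ insert v A ∧ adjPt a b) a b := by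
    intro a b hab
    induction hab with
    | refl => exact Relation.ReflTransGen.refl
    | tail _ h ih =>
      exact ih.tail ⟨Finset.mem_insert_of_mem h.1, Finset.mem_insert_of_mem h.2.1, h.2.2⟩
  have hto : ∀ a ∈ insert v A, Relation.ReflTransGen
      (fun a b => a ∈ insert v A ∧ b ∈ insert v A ∧ adjPt a b) a x := by
    intro a ha
    rcases Finset.mem_insert.1 ha with rfl | ha
    · exact Relation.ReflTransGen.single ⟨by simp, by simp [hx], adjPt_symm hxv⟩
    · exact mono _ _ (hA a ha x hx)
  have hfrom : ∀ a ∈ insert v A, Relation.ReflTransGen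
      (fun a b => a ∈ insert v A ∧ b ∈ insert v A ∧ adjPt a b) x a := by
    intro a ha
    rcases Finset.mem_insert.1 ha with rfl | ha
    · exact Relation.ReflTransGen.single ⟨by simp [hx], by simp, hxv⟩
    · exact mono _ _ (hA x hx a ha)
  intro a ha b hb
  exact (hto a ha).trans (hfrom b hb)

lemma ValidH.conn {h : List (Fin d → ℤ)} (hh : ValidH h) : IsConnCluster h.toFinset := by
  induction hh with
  | base =>
    intro x hx y hy
    simp at hx hy
    subst hx; subst hy
    exact Relation.ReflTransGen.refl
  | step v h _ hv ih =>
    obtain ⟨_, x, hx, hxv⟩ := hv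
    rw [List.toFinset_cons]
    exact conn_insert ih hx hxv

noncomputable def mm (μ : Set (Fin d → ℤ) → (Fin d → ℤ) → ℝ) (A : Finset (Fin d → ℤ))
    (v : Fin d → ℤ) : ℝ≥0∞ := ENNReal.ofReal (μ (obdry (A : Set (Fin d → ℤ))) v)

/-- expectation of a function of the history for the Markov version of the process -/
noncomputable def EE (μ : Set (Fin d → ℤ) → (Fin d → ℤ) → ℝ) :
    ℕ → (List (Fin d → ℤ) → ℝ≥0∞) → ℝ≥0∞
  | 0, φ => φ [0]
  | n + 1, φ => EE μ n (fun h => ∑' v, mm μ h.toFinset v * φ (v :: h))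

/-- weights of ordered chains ending at a point -/
noncomputable def ww (ρ : ℝ) (s : ℝ≥0∞) : List (Fin d → ℤ) → (Fin d → ℤ) → ℝ≥0∞
  | [], _ => 0
  | v :: h, x => ww ρ s h x + if x = v then (if ρ ≤ zNorm v then 1 else 0) +
      s * ∑' u, (if adjPt u v then ww ρ s h u else 0) else 0

noncomputable def TT (ρ : ℝ) (s : ℝ≥0∞) (h : List (Fin d → ℤ)) : ℝ≥0∞ := ∑' x, ww ρ s h x

lemma TT_cons (ρ : ℝ) (s : ℝ≥0∞) (v : Fin d → ℤ) (h : List (Fin d → ℤ)) :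
    TT ρ s (v :: h) = TT ρ s h + ((if ρ ≤ zNorm v then 1 else 0) +
      s * ∑' u, (if adjPt u v then ww ρ s h u else 0)) := by
  unfold TT
  simp only [ww]
  rw [ENNReal.tsum_add, tsum_ite_eq]

lemma ww_ne_zero {ρ : ℝ} {s : ℝ≥0∞} {h : List (Fin d → ℤ)} :
    ∀ {u : Fin d → ℤ}, ww ρ s h u ≠ 0 → ∃ x ∈ h, ρ ≤ zNorm x := by
  induction h with
  | nil => intro u hu; simp [ww] at hu
  | cons v h ih =>
    intro u hu
    by_contra hcon
    push Not at hcon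
    apply hu
    have hz : ∀ u, ww ρ s h u = 0 := by
      intro u
      by_contra h0
      obtain ⟨x, hx, hx'⟩ := ih h0
      exact absurd hx' (not_le.2 (hcon x (by simp [hx])))
    have hv : ¬ ρ ≤ zNorm v := not_le.2 (hcon v (by simp))
    simp [ww, hz, hv]

lemma ww_lower {ρ : ℝ} {s : ℝ≥0∞} (hρ : 0 < ρ) {h : List (Fin d → ℤ)}
    (hh : ValidH h) : ∀ (k : ℕ) (x : Fin d → ℤ), x ∈ h → ρ + k ≤ zNorm x →
      s ^ k ≤ ww ρ s h x := by
  induction hh with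
  | base =>
    intro k x hx hk
    simp at hx
    subst hx
    rw [zNorm_zero] at hk
    have : (0 : ℝ) ≤ k := Nat.cast_nonneg k
    linarith
  | step v h _ hv ih =>
    intro k x hx hk
    rcases List.mem_cons.1 hx with rfl | hx
    · have hk0 : (0 : ℝ) ≤ k := Nat.cast_nonneg k
      simp only [ww, if_true]
      refine le_trans ?_ le_add_self
      cases k with
      | zero =>
        have : ρ ≤ zNorm x := by linarith
        simp [this]
      | succ k =>
        obtain ⟨_, u, hu, hux⟩ := hv
        have h1 := zNorm_tri x u
        have h2 : zNorm (u - x) = 1 := hux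
        push_cast at hk
        have h3 := ih k u (by simpa using hu) (by linarith)
        refine le_trans ?_ le_add_self
        rw [pow_succ']
        refine mul_le_mul_right (le_trans ?_ (ENNReal.le_tsum u)) s
        simpa [hux] using h3
    · exact (ih k x hx hk).trans (by simp only [ww]; exact le_self_add)

lemma mm_tsum (hd : 2 ≤ d) {μ : Set (Fin d → ℤ) → (Fin d → ℤ) → ℝ} (hμ : IsDistFamily μ)
    {A : Finset (Fin d → ℤ)} {a : Fin d → ℤ} (ha : a ∈ A) : ∑' v, mm μ A v = 1 := by
  obtain ⟨b, hb, _⟩ := exists_far hd A ha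
  obtain ⟨h0, h1, h2⟩ := hμ _ (obdry_finite A) ⟨b, hb⟩
  unfold mm
  rw [← ENNReal.ofReal_tsum_of_nonneg h0, h2, ENNReal.ofReal_one]
  by_contra hns
  rw [tsum_eq_zero_of_not_summable hns] at h2
  norm_num at h2

lemma mm_zero (hd : 2 ≤ d) {μ : Set (Fin d → ℤ) → (Fin d → ℤ) → ℝ} (hμ : IsDistFamily μ)
    {A : Finset (Fin d → ℤ)} {a : Fin d → ℤ} (ha : a ∈ A) {v : Fin d → ℤ}
    (hv : v ∉ obdry (A : Set (Fin d → ℤ))) : mm μ A v = 0 := by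
  obtain ⟨b, hb, _⟩ := exists_far hd A ha
  obtain ⟨h0, h1, h2⟩ := hμ _ (obdry_finite A) ⟨b, hb⟩
  simp [mm, h1 v hv]

lemma EE_mono (hd : 2 ≤ d) {μ : Set (Fin d → ℤ) → (Fin d → ℤ) → ℝ} (hμ : IsDistFamily μ)
    (n : ℕ) : ∀ φ ψ : List (Fin d → ℤ) → ℝ≥0∞, (∀ h, ValidH h → φ h ≤ ψ h) →
      EE μ n φ ≤ EE μ n ψ := by
  induction n with
  | zero => intro φ ψ h; exact h _ ValidH.base
  | succ n ih =>
    intro φ ψ h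
    apply ih
    intro l hl
    apply ENNReal.tsum_le_tsum
    intro v
    by_cases hv : v ∈ obdry (l.toFinset : Set (Fin d → ℤ))
    · exact mul_le_mul_right (h _ (ValidH.step v l hl hv)) _
    · rw [mm_zero hd hμ (List.mem_toFinset.2 hl.zero_mem) hv]; simp

lemma nbr_sum_le (u : Fin d → ℤ) (f : (Fin d → ℤ) → ℝ≥0∞) (p : ℝ≥0∞) (hf : ∀ v, f v ≤ p) :
    ∑' v, (if adjPt u v then f v else 0) ≤ nbrCount d * p := by
  let N : Finset (Fin d → ℤ) := (unit_finite (d := d)).toFinset.image (fun e => u - e)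
  rw [tsum_eq_sum (s := N)]
  · calc ∑ v ∈ N, (if adjPt u v then f v else 0) ≤ ∑ v ∈ N, p := by
          apply Finset.sum_le_sum
          intro v _
          split_ifs
          · exact hf v
          · exact bot_le
      _ = (N.card : ℝ≥0∞) * p := by simp
      _ ≤ nbrCount d * p := by
          apply mul_le_mul_left
          exact_mod_cast Finset.card_image_le
  · intro v hv
    rw [if_neg]
    intro hadj
    apply hv
    simp only [N, Finset.mem_image, Set.Finite.mem_toFinset, Set.mem_ofPred_eq]
    exact ⟨u - v, hadj, by simp⟩

lemma step_le (hd : 2 ≤ d) {μ : Set (Fin d → ℤ) → (Fin d → ℤ) → ℝ} (hμ : IsDistFamily μ)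
    {ρ : ℝ} {s p : ℝ≥0∞}
    (hp : ∀ h : List (Fin d → ℤ), ValidH h → (∃ x ∈ h, ρ ≤ zNorm x) →
      ∀ v, mm μ h.toFinset v ≤ p)
    {h : List (Fin d → ℤ)} (hh : ValidH h) :
    ∑' v, mm μ h.toFinset v * TT ρ s (v :: h) ≤
      (1 + s * (nbrCount d * p)) * TT ρ s h + 1 := by
  have h1 := mm_tsum hd hμ (List.mem_toFinset.2 hh.zero_mem)
  have h2 : ∑' v, mm μ h.toFinset v * ∑' u, (if adjPt u v then ww ρ s h u else 0) ≤
      nbrCount d * p * TT ρ s h := by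
    calc ∑' v, mm μ h.toFinset v * ∑' u, (if adjPt u v then ww ρ s h u else 0)
        = ∑' v, ∑' u, mm μ h.toFinset v * (if adjPt u v then ww ρ s h u else 0) := by
          simp_rw [ENNReal.tsum_mul_left]
      _ = ∑' u, ∑' v, mm μ h.toFinset v * (if adjPt u v then ww ρ s h u else 0) :=
          ENNReal.tsum_comm
      _ = ∑' u, (∑' v, (if adjPt u v then mm μ h.toFinset v else 0)) * ww ρ s h u := by
          simp_rw [← ENNReal.tsum_mul_right]
          congr 1; ext u; congr 1; ext v
          split_ifs <;> simp
      _ ≤ ∑' u, nbrCount d * p * ww ρ s h u := by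
          apply ENNReal.tsum_le_tsum
          intro u
          by_cases hu : ww ρ s h u = 0
          · simp [hu]
          · exact mul_le_mul_left (nbr_sum_le u _ p (hp h hh (ww_ne_zero hu))) _
      _ = nbrCount d * p * TT ρ s h := by rw [ENNReal.tsum_mul_left, TT]
  calc ∑' v, mm μ h.toFinset v * TT ρ s (v :: h)
      ≤ ∑' v, (mm μ h.toFinset v * TT ρ s h + (mm μ h.toFinset v +
          s * (mm μ h.toFinset v * ∑' u, (if adjPt u v then ww ρ s h u else 0)))) := by
        apply ENNReal.tsum_le_tsum
        intro v
        rw [TT_cons, mul_add, mul_add]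
        refine add_le_add le_rfl (add_le_add ?_ (le_of_eq (by ring)))
        split_ifs <;> simp
    _ = TT ρ s h + (1 + s * ∑' v, mm μ h.toFinset v *
          ∑' u, (if adjPt u v then ww ρ s h u else 0)) := by
        rw [ENNReal.tsum_add, ENNReal.tsum_add, ENNReal.tsum_mul_right, ENNReal.tsum_mul_left,
          h1, one_mul]
    _ ≤ TT ρ s h + (1 + s * (nbrCount d * p * TT ρ s h)) := by gcongr
    _ = _ := by ring

lemma EE_TT (hd : 2 ≤ d) {μ : Set (Fin d → ℤ) → (Fin d → ℤ) → ℝ} (hμ : IsDistFamily μ)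
    {ρ : ℝ} (hρ : 0 < ρ) {s p : ℝ≥0∞}
    (hp : ∀ h : List (Fin d → ℤ), ValidH h → (∃ x ∈ h, ρ ≤ zNorm x) →
      ∀ v, mm μ h.toFinset v ≤ p) (n : ℕ) : ∀ a b : ℝ≥0∞,
    EE μ n (fun h => a * TT ρ s h + b) ≤ a * (1 + s * (nbrCount d * p)) ^ n * n + b := by
  induction n with
  | zero =>
    intro a b
    have : TT ρ s [(0 : Fin d → ℤ)] = 0 := by
      simp [TT, ww, zNorm_zero, hρ]
    simp [EE, this]
  | succ n ih =>
    intro a b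
    set D := 1 + s * (nbrCount d * p) with hD
    have hD1 : 1 ≤ D := le_self_add
    calc EE μ (n + 1) (fun h => a * TT ρ s h + b)
        ≤ EE μ n (fun h => (a * D) * TT ρ s h + (a + b)) := by
          apply EE_mono hd hμ
          intro h hh
          have h1 := mm_tsum hd hμ (List.mem_toFinset.2 hh.zero_mem)
          calc ∑' v, mm μ h.toFinset v * (a * TT ρ s (v :: h) + b)
              = a * ∑' v, mm μ h.toFinset v * TT ρ s (v :: h) + b := by
                have hb : b = ∑' v, mm μ h.toFinset v * b := by
                  rw [ENNReal.tsum_mul_right, h1, one_mul]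
                calc _ = ∑' v, (a * (mm μ h.toFinset v * TT ρ s (v :: h)) +
                      mm μ h.toFinset v * b) := by congr 1; ext v; ring
                  _ = _ := by rw [ENNReal.tsum_add, ENNReal.tsum_mul_left, ← hb]
            _ ≤ a * (D * TT ρ s h + 1) + b := by
                gcongr
                exact step_le hd hμ hp hh
            _ = _ := by ring
      _ ≤ a * D * D ^ n * n + (a + b) := ih _ _
      _ ≤ a * D ^ (n + 1) * (n + 1 : ℕ) + b := by
          have : (1 : ℝ≥0∞) ≤ D ^ (n + 1) := one_le_pow₀ hD1
          calc a * D * D ^ n * n + (a + b) = a * D ^ (n + 1) * n + a * 1 + b := by ring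
            _ ≤ a * D ^ (n + 1) * n + a * D ^ (n + 1) + b := by gcongr
            _ = _ := by push_cast; ring

lemma law_le {Ω : Type*} [MeasurableSpace Ω]
    (P : Measure Ω) [IsProbabilityMeasure P]
    (μ : Set (Fin d → ℤ) → (Fin d → ℤ) → ℝ)
    (F : ℕ → Ω → Finset (Fin d → ℤ)) (y : ℕ → Ω → (Fin d → ℤ))
    (hagg : IsIncrementalAggregation P μ F y) (n : ℕ) :
    ∀ g : Finset (Fin d → ℤ) → ℝ≥0∞,
      ∑' A, P {ω | F (n + 1) ω = A} * g A ≤ EE μ n (fun h => g h.toFinset) := by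
  obtain ⟨h1, h2, h3⟩ := hagg
  induction n with
  | zero =>
    intro g
    rw [tsum_eq_single {0}]
    · simp only [EE]
      calc P {ω | F (0 + 1) ω = {0}} * g {0} ≤ 1 * g {0} := by gcongr; exact prob_le_one
        _ = _ := by simp
    · intro A hA
      have : P {ω | F (0 + 1) ω = A} = 0 := by
        refine measure_mono_null ?_ (ae_iff.1 h1)
        intro ω hω hc
        apply hA
        rw [← hc.1]
        exact hω.symm
      simp [this]
  | succ n ih =>
    intro g
    have key : ∀ B, P {ω | F (n + 1 + 1) ω = B} ≤
        ∑' q : Finset (Fin d → ℤ) × (Fin d → ℤ), (if insert q.2 q.1 = B then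
          mm μ q.1 q.2 * P {ω | F (n + 1) ω = q.1} else 0) := by
      intro B
      have hsub : {ω | F (n + 1 + 1) ω = B} ⊆
          ⋃ q : Finset (Fin d → ℤ) × (Fin d → ℤ), (if insert q.2 q.1 = B then
            ({ω | y (n + 1 + 1) ω = q.2} ∩ {ω | F (n + 1) ω = q.1}) else ∅) := by
        intro ω hω
        have hω' : F (n + 1 + 1) ω = B := hω
        rw [h2 (n + 1) (by omega) ω] at hω'
        refine Set.mem_iUnion.2 ⟨(F (n + 1) ω, y (n + 1 + 1) ω), ?_⟩
        rw [if_pos (by convert hω')]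
        exact ⟨rfl, rfl⟩
      refine (measure_mono hsub).trans ((measure_iUnion_le _).trans ?_)
      apply ENNReal.tsum_le_tsum
      intro q
      split_ifs
      · rw [h3 (n + 1) (by omega)]; rfl
      · simp
    calc ∑' B, P {ω | F (n + 1 + 1) ω = B} * g B
        ≤ ∑' B, (∑' q : Finset (Fin d → ℤ) × (Fin d → ℤ), (if insert q.2 q.1 = B then
          mm μ q.1 q.2 * P {ω | F (n + 1) ω = q.1} else 0)) * g B := by
          apply ENNReal.tsum_le_tsum
          intro B
          exact mul_le_mul_left (key B) _
      _ = ∑' q : Finset (Fin d → ℤ) × (Fin d → ℤ), ∑' B, (if B = insert q.2 q.1 then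
          mm μ q.1 q.2 * P {ω | F (n + 1) ω = q.1} * g (insert q.2 q.1) else 0) := by
          simp_rw [← ENNReal.tsum_mul_right]
          rw [ENNReal.tsum_comm]
          congr 1; ext q; congr 1; ext B
          by_cases hB : insert q.2 q.1 = B
          · simp [hB]
          · simp [hB, Ne.symm hB]
      _ = ∑' q : Finset (Fin d → ℤ) × (Fin d → ℤ),
          mm μ q.1 q.2 * P {ω | F (n + 1) ω = q.1} * g (insert q.2 q.1) := by
          simp_rw [tsum_ite_eq]
      _ = ∑' A, P {ω | F (n + 1) ω = A} * ∑' v, mm μ A v * g (insert v A) := by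
          rw [ENNReal.tsum_prod']
          congr 1; ext A
          rw [← ENNReal.tsum_mul_left]
          congr 1; ext v; ring
      _ ≤ _ := by
          refine (ih _).trans (le_of_eq ?_)
          simp only [EE, List.toFinset_cons]

/-- The probability that the cluster at time `n+1` has a point of norm `≥ ρ + k`. -/
lemma far_le (hd : 2 ≤ d) {Ω : Type*} [MeasurableSpace Ω]
    (P : Measure Ω) [IsProbabilityMeasure P]
    (μ : Set (Fin d → ℤ) → (Fin d → ℤ) → ℝ) (hμ : IsDistFamily μ)
    (F : ℕ → Ω → Finset (Fin d → ℤ)) (y : ℕ → Ω → (Fin d → ℤ))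
    (hagg : IsIncrementalAggregation P μ F y) {ρ : ℝ} (hρ : 0 < ρ) {s p : ℝ≥0∞}
    (hs : 1 ≤ s) (hs' : s ≠ ⊤)
    (hp : ∀ h : List (Fin d → ℤ), ValidH h → (∃ x ∈ h, ρ ≤ zNorm x) →
      ∀ v, mm μ h.toFinset v ≤ p) (n k : ℕ) :
    P {ω | ∃ x ∈ F (n + 1) ω, ρ + k ≤ zNorm x} ≤
      (s ^ k)⁻¹ * (1 + s * (nbrCount d * p)) ^ n * n := by
  let g : Finset (Fin d → ℤ) → ℝ≥0∞ := fun A => if ∃ x ∈ A, ρ + k ≤ zNorm x then 1 else 0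
  have h1 : P {ω | ∃ x ∈ F (n + 1) ω, ρ + k ≤ zNorm x} ≤
      ∑' A, P {ω | F (n + 1) ω = A} * g A := by
    have hsub : {ω | ∃ x ∈ F (n + 1) ω, ρ + k ≤ zNorm x} ⊆
        ⋃ A : Finset (Fin d → ℤ), (if ∃ x ∈ A, ρ + k ≤ zNorm x then
          {ω | F (n + 1) ω = A} else ∅) := by
      intro ω hω
      refine Set.mem_iUnion.2 ⟨F (n + 1) ω, ?_⟩
      have hω' : ∃ x ∈ F (n + 1) ω, ρ + k ≤ zNorm x := hω
      rw [if_pos hω']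
      rfl
    refine (measure_mono hsub).trans ((measure_iUnion_le _).trans ?_)
    apply ENNReal.tsum_le_tsum
    intro A
    simp only [g]
    split_ifs <;> simp
  have hs0 : s ^ k ≠ 0 := pow_ne_zero _ (by rintro rfl; simp at hs)
  have hst : s ^ k ≠ ⊤ := ENNReal.pow_ne_top hs'
  refine h1.trans ((law_le P μ F y hagg n g).trans ?_)
  have h2 := EE_TT hd hμ hρ (s := s) hp n (s ^ k)⁻¹ 0
  rw [add_zero] at h2
  refine le_trans (EE_mono hd hμ n _ _ ?_) h2
  intro h hh
  simp only [g, add_zero]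
  split_ifs with hx
  · obtain ⟨x, hx, hx'⟩ := hx
    have h3 := (ww_lower (s := s) hρ hh k x (List.mem_toFinset.1 hx) hx').trans (ENNReal.le_tsum x)
    calc (1 : ℝ≥0∞) = (s ^ k)⁻¹ * s ^ k := (ENNReal.inv_mul_cancel hs0 hst).symm
      _ ≤ _ := by gcongr; exact h3
  · exact bot_le

lemma mm_le (hd : 2 ≤ d)
    (μ : Set (Fin d → ℤ) → (Fin d → ℤ) → ℝ) (hμ : IsDistFamily μ) (C q : ℝ)
    (hBeurling : ∀ r : ℝ, 1 < r → ∀ B : Finset (Fin d → ℤ), IsOuterBdry B →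
      r ≤ rad B → ∀ z ∈ B, μ (B : Set (Fin d → ℤ)) z ≤ C * r ^ (-q))
    {ρ : ℝ} (hρ : 1 < ρ) (h : List (Fin d → ℤ)) (hh : ValidH h)
    (hx : ∃ x ∈ h, ρ ≤ zNorm x) (v : Fin d → ℤ) :
    mm μ h.toFinset v ≤ ENNReal.ofReal (C * ρ ^ (-q)) := by
  by_cases hv : v ∈ obdry (h.toFinset : Set (Fin d → ℤ))
  · obtain ⟨x, hx, hxρ⟩ := hx
    let B := (obdry_finite h.toFinset).toFinset
    have hB : (B : Set (Fin d → ℤ)) = obdry (h.toFinset : Set (Fin d → ℤ)) := by simp [B]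
    obtain ⟨b, hb, hbx⟩ := exists_far hd h.toFinset (List.mem_toFinset.2 hx)
    have hbB : b ∈ B := by rw [← Finset.mem_coe, hB]; exact hb
    have hrad : ρ ≤ rad B := by
      rw [rad, dif_pos ⟨b, hbB⟩]
      exact (hxρ.trans hbx).trans (Finset.le_sup' zNorm hbB)
    have := hBeurling ρ hρ B ⟨h.toFinset, hh.conn, List.mem_toFinset.2 hh.zero_mem, hB⟩ hrad v
      (by rw [← Finset.mem_coe, hB]; exact hv)
    rw [hB] at this
    exact ENNReal.ofReal_le_ofReal this
  · rw [mm_zero hd hμ (List.mem_toFinset.2 hh.zero_mem) hv]; exact bot_le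

lemma F_mono {Ω : Type*} [MeasurableSpace Ω]
    (P : Measure Ω) (μ : Set (Fin d → ℤ) → (Fin d → ℤ) → ℝ)
    (F : ℕ → Ω → Finset (Fin d → ℤ)) (y : ℕ → Ω → (Fin d → ℤ))
    (hagg : IsIncrementalAggregation P μ F y) (ω : Ω) {m n : ℕ} (hm : 1 ≤ m) (hmn : m ≤ n) :
    F m ω ⊆ F n ω := by
  induction n, hmn using Nat.le_induction with
  | base => exact subset_rfl
  | succ n hn ih =>
    rw [hagg.2.1 n (hm.trans hn) ω]
    exact ih.trans (Finset.subset_insert _ _)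

/-- The key probability bound with an explicit time `n + 1`. -/
lemma W_sub {Ω : Type*} [MeasurableSpace Ω]
    (P : Measure Ω) (μ : Set (Fin d → ℤ) → (Fin d → ℤ) → ℝ)
    (F : ℕ → Ω → Finset (Fin d → ℤ)) (y : ℕ → Ω → (Fin d → ℤ))
    (hagg : IsIncrementalAggregation P μ F y) (β q : ℝ) (r : ℕ) (n : ℕ)
    (hn : ∀ j : ℕ, (j : ℝ) ≤ β * (r : ℝ) ^ ((1 : ℝ) + q) → j ≤ n + 1) :
    P (⋃ z ∈ {z : Fin (r + 1) → (Fin d → ℤ) | IsZrPath r z}, WrEvent y β q r z) ≤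
      P {ω | ∃ x ∈ F (n + 1) ω, (r : ℝ) ≤ zNorm x} := by
  apply measure_mono_ae
  filter_upwards [hagg.1] with ω hω hW
  have hW' : ω ∈ ⋃ z ∈ {z : Fin (r + 1) → (Fin d → ℤ) | IsZrPath r z},
    WrEvent y β q r z := hW
  simp only [Set.mem_iUnion] at hW'
  obtain ⟨z, hz, j, _, hj2, hj3⟩ := hW'
  refine ⟨z 0, ?_, hz.1.1⟩
  have hjm : z 0 ∈ F (j 0) ω := by
    rw [← hj3 0]
    rcases Nat.lt_or_ge 1 (j 0) with h | h
    · obtain ⟨m, hm⟩ : ∃ m, j 0 = m + 1 := ⟨j 0 - 1, by omega⟩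
      rw [hm, hagg.2.1 m (by omega) ω]
      exact Finset.mem_insert_self _ _
    · have : j 0 = 1 := le_antisymm h (hj2 0).1
      rw [this, hω.1, hω.2]; simp
  exact F_mono P μ F y hagg ω (hj2 0).1 (hn _ (hj2 0).2) hjm

lemma real_bound (K C q s : ℝ) (hK : 0 ≤ K) (hC : 0 < C) (hq : 0 < q) (hs : s = Real.exp 6)
    (β : ℝ) (hβ : β = (s * (K + 1) * C * 2 ^ q)⁻¹) (r k n : ℕ) (hr : 4 ≤ r) (hk : k = r / 2)
    (hn : (n : ℝ) ≤ β * (r : ℝ) ^ (1 + q))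
    (hlarge : (r : ℝ) ^ (1 + q) ≤ Real.exp r) :
    (s ^ k)⁻¹ * (1 + s * (K * (C * ((r : ℝ) - k) ^ (-q)))) ^ n * n ≤
      (β * Real.exp 3) * Real.exp (-1) ^ r := by
  have hs0 : 0 < s := hs ▸ Real.exp_pos _
  have hr0 : (0 : ℝ) < r := by exact_mod_cast (by omega : 0 < r)
  have h2q : (0 : ℝ) < 2 ^ q := Real.rpow_pos_of_pos two_pos _
  have hβ0 : 0 < β := by rw [hβ]; positivity
  have hk1 : (k : ℝ) ≤ r / 2 := by
    rw [hk]; exact_mod_cast Nat.cast_div_le (α := ℝ) (m := r) (n := 2)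
  have hk2 : (r : ℝ) - 1 ≤ 2 * k := by
    have : r ≤ 2 * k + 1 := by omega
    have : (r : ℝ) ≤ 2 * k + 1 := by exact_mod_cast this
    linarith
  have hρ : ((r : ℝ) - k) ^ (-q) ≤ (r / 2 : ℝ) ^ (-q) :=
    Real.rpow_le_rpow_of_nonpos (by positivity) (by linarith) (by linarith)
  have hρ0 : 0 ≤ ((r : ℝ) - k) ^ (-q) := Real.rpow_nonneg (by linarith) _
  have hhalf : (r / 2 : ℝ) ^ (-q) = 2 ^ q * (r : ℝ) ^ (-q) := by
    rw [Real.div_rpow hr0.le two_pos.le, Real.rpow_neg two_pos.le]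
    field_simp
  have hrr : (r : ℝ) ^ (-q) * (r : ℝ) ^ (1 + q) = r := by
    rw [← Real.rpow_add hr0]; simp
  set ε := s * (K * (C * ((r : ℝ) - k) ^ (-q))) with hε
  have hε0 : 0 ≤ ε := by positivity
  have hεn : ε * n ≤ r := by
    calc ε * n ≤ (s * ((K + 1) * (C * (2 ^ q * (r : ℝ) ^ (-q))))) *
          (β * (r : ℝ) ^ (1 + q)) := by
          rw [← hhalf]
          have : K ≤ K + 1 := by linarith
          rw [hε]
          gcongr
      _ = (s * (K + 1) * C * 2 ^ q) * β * ((r : ℝ) ^ (-q) * (r : ℝ) ^ (1 + q)) := by ring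
      _ = r := by
          rw [hrr, hβ, mul_inv_cancel₀ (by positivity), one_mul]
  have hpow : (1 + ε) ^ n ≤ Real.exp r := by
    calc (1 + ε) ^ n ≤ (Real.exp ε) ^ n := by
          gcongr
          linarith [Real.add_one_le_exp ε]
      _ = Real.exp (ε * n) := by rw [← Real.exp_nat_mul]; ring_nf
      _ ≤ _ := Real.exp_le_exp.2 hεn
  have hsk : (s ^ k)⁻¹ ≤ Real.exp (3 - 3 * r) := by
    rw [hs, ← Real.exp_nat_mul, ← Real.exp_neg]
    apply Real.exp_le_exp.2
    linarith
  have hn' : (n : ℝ) ≤ β * Real.exp r := hn.trans (by gcongr)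
  calc (s ^ k)⁻¹ * (1 + ε) ^ n * n ≤ Real.exp (3 - 3 * r) * Real.exp r * (β * Real.exp r) := by
        gcongr
    _ = (β * Real.exp 3) * Real.exp (-1) ^ r := by
        rw [← Real.exp_nat_mul]
        have : Real.exp (3 - 3 * r) * Real.exp r * Real.exp r =
            Real.exp 3 * Real.exp (r * -1) := by
          rw [← Real.exp_add, ← Real.exp_add, ← Real.exp_add]; ring_nf
        linear_combination β * this

end helpers

/-- under the Beurling-type estimate, there are `β > 0`, `c₁ > 0`,
`θ ∈ (0,1)` and `r₀` such that `ℙ(W_r) ≤ c₁·r^{d-1}·θ^r` for all `r ≥ r₀`, where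
`W_r = ⋃_{z ∈ Z_r} W_r(z)`. -/
theorem stmt7 {d : ℕ} (hd : 2 ≤ d) {Ω : Type*} [MeasurableSpace Ω]
    (P : Measure Ω) [IsProbabilityMeasure P]
    (μ : Set (Fin d → ℤ) → (Fin d → ℤ) → ℝ) (hμ : IsDistFamily μ)
    (C q : ℝ) (hC : 0 < C) (hq : 0 < q)
    (hBeurling : ∀ r : ℝ, 1 < r → ∀ B : Finset (Fin d → ℤ), IsOuterBdry B →
      r ≤ rad B → ∀ z ∈ B, μ (B : Set (Fin d → ℤ)) z ≤ C * r ^ (-q))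
    (F : ℕ → Ω → Finset (Fin d → ℤ)) (y : ℕ → Ω → (Fin d → ℤ))
    (hagg : IsIncrementalAggregation P μ F y) :
    ∃ β c₁ θ : ℝ, 0 < β ∧ 0 < c₁ ∧ 0 < θ ∧ θ < 1 ∧ ∃ r₀ : ℕ,
      ∀ r : ℕ, r₀ ≤ r →
        P (⋃ z ∈ {z : Fin (r + 1) → (Fin d → ℤ) | IsZrPath r z}, WrEvent y β q r z)
          ≤ ENNReal.ofReal (c₁ * (r : ℝ) ^ (d - 1) * θ ^ r) := by
  classical
  set s : ℝ := Real.exp 6 with hs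
  set K : ℝ := (nbrCount d : ℝ) with hK
  have hK0 : 0 ≤ K := Nat.cast_nonneg _
  have h2q : (0 : ℝ) < 2 ^ q := Real.rpow_pos_of_pos two_pos _
  have hs0 : 0 < s := Real.exp_pos _
  set β : ℝ := (s * (K + 1) * C * 2 ^ q)⁻¹ with hβ
  have hβ0 : 0 < β := by positivity
  have hev : ∀ᶠ r : ℕ in atTop, (r : ℝ) ^ (1 + q) ≤ Real.exp r := by
    have h := (isLittleO_rpow_exp_atTop (1 + q)).bound one_pos
    have h' := tendsto_natCast_atTop_atTop (R := ℝ) |>.eventually h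
    filter_upwards [h'] with r hr
    rw [one_mul, Real.norm_of_nonneg (Real.exp_pos _).le] at hr
    exact (le_abs_self _).trans hr
  obtain ⟨r₁, hr₁⟩ := eventually_atTop.1 hev
  refine ⟨β, β * Real.exp 3, Real.exp (-1), hβ0, by positivity, Real.exp_pos _,
    by simp, max r₁ 4, ?_⟩
  intro r hr
  have hr4 : 4 ≤ r := (le_max_right _ _).trans hr
  have hr1 := hr₁ r ((le_max_left _ _).trans hr)
  set M : ℕ := ⌊β * (r : ℝ) ^ ((1 : ℝ) + q)⌋₊ with hM
  set n : ℕ := M - 1 with hn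
  have hx0 : 0 ≤ β * (r : ℝ) ^ ((1 : ℝ) + q) := by positivity
  have hMle : (M : ℝ) ≤ β * (r : ℝ) ^ ((1 : ℝ) + q) := Nat.floor_le hx0
  have hnle : (n : ℝ) ≤ β * (r : ℝ) ^ ((1 : ℝ) + q) :=
    le_trans (by exact_mod_cast (by omega : n ≤ M)) hMle
  have hW := W_sub P μ F y hagg β q r n (by
    intro j hj
    have : j ≤ M := Nat.le_floor hj
    omega)
  set k : ℕ := r / 2 with hk
  have hkr : k + 2 ≤ r := by omega
  have hkr' : (k : ℝ) + 2 ≤ r := by exact_mod_cast hkr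
  have hρ : (1 : ℝ) < (r : ℝ) - k := by linarith
  have hfar := far_le hd P μ hμ F y hagg (ρ := (r : ℝ) - k) (by linarith)
    (s := ENNReal.ofReal s) (p := ENNReal.ofReal (C * ((r : ℝ) - k) ^ (-q)))
    (by rw [ENNReal.one_le_ofReal]; exact Real.one_le_exp (by norm_num))
    ENNReal.ofReal_ne_top
    (fun h hh hx v => mm_le hd μ hμ C q hBeurling hρ h hh hx v) n k
  rw [sub_add_cancel] at hfar
  refine hW.trans (hfar.trans ?_)
  have hρ0 : 0 ≤ ((r : ℝ) - k) ^ (-q) := Real.rpow_nonneg (by linarith) _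
  have hb := real_bound K C q s hK0 hC hq hs β hβ r k n hr4 hk hnle hr1
  have hp0 : 0 ≤ C * ((r : ℝ) - k) ^ (-q) := by positivity
  have heq : (ENNReal.ofReal s ^ k)⁻¹ * (1 + ENNReal.ofReal s * ((nbrCount d : ENNReal) *
      ENNReal.ofReal (C * ((r : ℝ) - k) ^ (-q)))) ^ n * n =
      ENNReal.ofReal ((s ^ k)⁻¹ * (1 + s * (K * (C * ((r : ℝ) - k) ^ (-q)))) ^ n * n) := by
    generalize C * ((r : ℝ) - k) ^ (-q) = p at hp0 ⊢
    rw [ENNReal.ofReal_mul (by positivity), ENNReal.ofReal_mul (by positivity),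
      ENNReal.ofReal_inv_of_pos (by positivity), ENNReal.ofReal_pow hs0.le,
      ENNReal.ofReal_pow (by positivity), ENNReal.ofReal_add zero_le_one (by positivity),
      ENNReal.ofReal_mul hs0.le, ENNReal.ofReal_mul hK0, ENNReal.ofReal_one,
      ENNReal.ofReal_natCast, ENNReal.ofReal_natCast]
  rw [heq]
  apply ENNReal.ofReal_le_ofReal
  refine hb.trans ?_
  have h1 : (1 : ℝ) ≤ (r : ℝ) ^ (d - 1) :=
    one_le_pow₀ (by exact_mod_cast (by omega : 1 ≤ r))
  have h2 : 0 < Real.exp (-1) ^ r := by positivity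
  have h3 : 0 < β * Real.exp 3 := by positivity
  exact mul_le_mul_of_nonneg_right (le_mul_of_one_le_right h3.le h1) h2.le
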